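/- (Second comparison lemma.) Fix t > 0 and finite sets x, y ⊆ [0,∞). For a finite initial set z, write F^z_{s,t}(k) := |Y^z_k ∩ [s,t]| for 0 ≤ s ≤ t, where (Y^z_k)_{k≥0} solves the recursion started from z driven by a common sequence (σ_k)_{k≥1} in (0,∞) whose values are all distinct from each other and from the points of x ∪ y (so no ties occur). If F^x_{s,t}(0) ≤ F^y_{s,t}(0) for all s ∈ [0,t], then F^x_{s,t}(k) ≤ F^y_{s,t}(k) for all s ∈ [0,t] and all k ≥ 0. -/

import Mathlib

open Set

noncomputable section

/-- One step of the chain on `[0,∞)`: with `N = min (Y ∪ {∞})`, add `u`, and if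
`N < u` also remove `N`. (If `Y = ∅` then `N = ∞`, so `u` is simply added.) -/
def Ystep (A : Finset ℝ) (u : ℝ) : Finset ℝ :=
  if h : A.Nonempty then
    if u < A.min' h then insert u A else (insert u A).erase (A.min' h)
  else insert u A

/-- The chain `Y_k` started from the finite set `y`, driven by the sequence `σ`. -/
def Ychain (y : Finset ℝ) (σ : ℕ → ℝ) : ℕ → Finset ℝ
  | 0 => y
  | k + 1 => Ystep (Ychain y σ k) (σ k)

/-- `F^z_{s,t}(k) := |Y^z_k ∩ [s,t]|`, the number of points of the chain started from
`z` lying in `[s,t]` at step `k`. -/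
def Fst (z : Finset ℝ) (σ : ℕ → ℝ) (s t : ℝ) (k : ℕ) : ℕ :=
  ((Ychain z σ k).filter (fun r => s ≤ r ∧ r ≤ t)).card

/-- The step on `A` driven by `u` deletes a point of `[s,t]`. -/
def Deletes (A : Finset ℝ) (u s t : ℝ) : Prop :=
  ∃ n ∈ A, (∀ m ∈ A, n ≤ m) ∧ n < u ∧ s ≤ n ∧ n ≤ t

open scoped Classical in
theorem card_filter_Ystep {A : Finset ℝ} {u : ℝ} (hu : u ∉ A) (s t : ℝ) :
    ((Ystep A u).filter (fun r => s ≤ r ∧ r ≤ t)).card + (if Deletes A u s t then 1 else 0) =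
      (A.filter (fun r => s ≤ r ∧ r ≤ t)).card + (if s ≤ u ∧ u ≤ t then 1 else 0) := by
  have hins : ((insert u A).filter (fun r => s ≤ r ∧ r ≤ t)).card =
      (A.filter (fun r => s ≤ r ∧ r ≤ t)).card + (if s ≤ u ∧ u ≤ t then 1 else 0) := by
    rw [Finset.filter_insert]
    split_ifs
    · exact Finset.card_insert_of_notMem (by simp [hu])
    · rfl
  rw [← hins]
  unfold Ystep
  split_ifs with hA hlt hD hD hD
  · obtain ⟨n, hn, -, hnu, -⟩ := hD
    exact absurd (A.min'_le n hn) (by linarith)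
  · rfl
  · obtain ⟨n, hn, hmin, -, hst⟩ := hD
    have hn_eq : A.min' hA = n := le_antisymm (A.min'_le n hn) (hmin _ (A.min'_mem hA))
    rw [hn_eq, Finset.filter_erase]
    exact Finset.card_erase_add_one
      (Finset.mem_filter.2 ⟨Finset.mem_insert_of_mem hn, hst⟩)
  · have hmem := A.min'_mem hA
    have hne : A.min' hA ≠ u := fun h => hu (h ▸ hmem)
    rw [Finset.filter_erase, Finset.erase_eq_of_notMem, add_zero]
    intro h
    exact hD ⟨_, hmem, fun m hm => A.min'_le m hm, lt_of_le_of_ne (not_lt.1 hlt) hne,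
      (Finset.mem_filter.1 h).2⟩
  · obtain ⟨n, hn, -⟩ := hD
    exact absurd ⟨n, hn⟩ hA
  · rfl

theorem Ystep_subset (A : Finset ℝ) (u : ℝ) : Ystep A u ⊆ insert u A := by
  unfold Ystep
  split_ifs
  · exact subset_rfl
  · exact Finset.erase_subset _ _
  · exact subset_rfl

theorem mem_Ychain {z : Finset ℝ} {σ : ℕ → ℝ} {k : ℕ} {a : ℝ} (ha : a ∈ Ychain z σ k) :
    a ∈ z ∨ ∃ j < k, σ j = a := by
  induction k with
  | zero => exact Or.inl ha
  | succ k ih =>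
    rcases Finset.mem_insert.1 (Ystep_subset _ _ ha) with rfl | h
    · exact Or.inr ⟨k, k.lt_succ_self, rfl⟩
    · exact (ih h).imp_right fun ⟨j, hj, e⟩ => ⟨j, hj.trans k.lt_succ_self, e⟩

theorem notMem_Ychain {z : Finset ℝ} {σ : ℕ → ℝ} (hσ : Function.Injective σ)
    (hz : ∀ a ∈ z, ∀ k, σ k ≠ a) (k : ℕ) : σ k ∉ Ychain z σ k := by
  intro h
  rcases mem_Ychain h with h | ⟨j, hj, e⟩
  · exact hz _ h k rfl
  · exact hj.ne (hσ e)

theorem Ychain_nonneg {z : Finset ℝ} {σ : ℕ → ℝ} (hσ : ∀ k, 0 < σ k)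
    (hz : ∀ a ∈ z, 0 ≤ a) {k : ℕ} {a : ℝ} (ha : a ∈ Ychain z σ k) : 0 ≤ a := by
  rcases mem_Ychain ha with h | ⟨j, -, rfl⟩
  · exact hz a h
  · exact (hσ j).le

/-- If the step on `B` deletes a point of `[s,t]` and the one on `A` does not, then `B` had
strictly more points than `A` in `[s,t]`. -/
theorem card_filter_lt_of_deletes {A B : Finset ℝ} {u s t : ℝ} (huA : u ∉ A)
    (hA : ∀ a ∈ A, 0 ≤ a)
    (hAB : ∀ r ∈ Set.Icc 0 t, (A.filter (fun a => r ≤ a ∧ a ≤ t)).card ≤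
      (B.filter (fun a => r ≤ a ∧ a ≤ t)).card)
    (hDB : Deletes B u s t) (hDA : ¬ Deletes A u s t) :
    (A.filter (fun a => s ≤ a ∧ a ≤ t)).card < (B.filter (fun a => s ≤ a ∧ a ≤ t)).card := by
  obtain ⟨n, hn, hmin, hnu, hsn, hnt⟩ := hDB
  have hnB : n ∈ B.filter (fun a => s ≤ a ∧ a ≤ t) := Finset.mem_filter.2 ⟨hn, hsn, hnt⟩
  rcases (A.filter (fun a => a ≤ t)).eq_empty_or_nonempty with he | hne
  · have h0 : A.filter (fun a => s ≤ a ∧ a ≤ t) = ∅ :=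
      Finset.filter_eq_empty_iff.2 fun a ha h => Finset.filter_eq_empty_iff.1 he ha h.2
    rw [h0, Finset.card_empty]
    exact Finset.card_pos.2 ⟨n, hnB⟩
  obtain ⟨m, hm, hm_le⟩ := Finset.exists_min_image _ id hne
  obtain ⟨hmA, hmt⟩ := Finset.mem_filter.1 hm
  have hmin' : ∀ a ∈ A, m ≤ a := fun a ha => by
    by_cases h : a ≤ t
    · exact hm_le a (Finset.mem_filter.2 ⟨ha, h⟩)
    · linarith
  have hle := hAB m ⟨hA m hmA, hmt⟩
  rcases lt_or_ge m s with hms | hsm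
  · calc (A.filter (fun a => s ≤ a ∧ a ≤ t)).card
        < (A.filter (fun a => m ≤ a ∧ a ≤ t)).card := by
          refine Finset.card_lt_card (Finset.ssubset_iff_of_subset ?_ |>.2
            ⟨m, by simp [hmA, hmt], by simp [hms]⟩)
          exact Finset.monotone_filter_right _ fun a _ h => ⟨hms.le.trans h.1, h.2⟩
      _ ≤ (B.filter (fun a => m ≤ a ∧ a ≤ t)).card := hle
      _ ≤ (B.filter (fun a => s ≤ a ∧ a ≤ t)).card := by
          refine Finset.card_le_card fun a ha => ?_
          obtain ⟨haB, -, hat⟩ := Finset.mem_filter.1 ha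
          exact Finset.mem_filter.2 ⟨haB, hsn.trans (hmin a haB), hat⟩
  · have hum : u < m := by
      refine lt_of_le_of_ne (not_lt.1 fun h => hDA ⟨m, hmA, hmin', h, hsm, hmt⟩) ?_
      rintro rfl
      exact huA hmA
    calc (A.filter (fun a => s ≤ a ∧ a ≤ t)).card
        ≤ (A.filter (fun a => m ≤ a ∧ a ≤ t)).card := by
          refine Finset.card_le_card fun a ha => ?_
          obtain ⟨haA, -, hat⟩ := Finset.mem_filter.1 ha
          exact Finset.mem_filter.2 ⟨haA, hmin' a haA, hat⟩
      _ ≤ (B.filter (fun a => m ≤ a ∧ a ≤ t)).card := hle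
      _ < (B.filter (fun a => s ≤ a ∧ a ≤ t)).card := by
          refine Finset.card_lt_card (Finset.ssubset_iff_of_subset ?_ |>.2
            ⟨n, hnB, by simp [hnu.trans hum]⟩)
          exact Finset.monotone_filter_right _ fun a _ h => ⟨hsm.trans h.1, h.2⟩

theorem card_filter_Ystep_le {A B : Finset ℝ} {u t : ℝ} (huA : u ∉ A) (huB : u ∉ B)
    (hA : ∀ a ∈ A, 0 ≤ a)
    (hAB : ∀ r ∈ Set.Icc 0 t, (A.filter (fun a => r ≤ a ∧ a ≤ t)).card ≤
      (B.filter (fun a => r ≤ a ∧ a ≤ t)).card) :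
    ∀ s ∈ Set.Icc 0 t, ((Ystep A u).filter (fun a => s ≤ a ∧ a ≤ t)).card ≤
      ((Ystep B u).filter (fun a => s ≤ a ∧ a ≤ t)).card := by
  classical
  intro s hs
  have h1 := card_filter_Ystep huA s t
  have h2 := card_filter_Ystep huB s t
  have h3 := hAB s hs
  by_cases hDB : Deletes B u s t
  · by_cases hDA : Deletes A u s t
    · rw [if_pos hDA] at h1
      rw [if_pos hDB] at h2
      omega
    · have h4 := card_filter_lt_of_deletes huA hA hAB hDB hDA
      rw [if_neg hDA] at h1
      rw [if_pos hDB] at h2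
      omega
  · rw [if_neg hDB] at h2
    omega

/-- **Second comparison lemma.** Fix `t > 0` and finite `x, y ⊆ [0,∞)`, and drive both
chains by a common tie-free sequence `(σ_k)` in `(0,∞)`. If `F^x_{s,t}(0) ≤ F^y_{s,t}(0)`
for all `s ∈ [0,t]`, then `F^x_{s,t}(k) ≤ F^y_{s,t}(k)` for all `s ∈ [0,t]` and `k ≥ 0`. -/
theorem second_comparison
    (σ : ℕ → ℝ) (hσpos : ∀ k, 0 < σ k) (hσinj : Function.Injective σ)
    (t : ℝ) (ht : 0 < t)
    (x y : Finset ℝ)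
    (hx0 : (x : Set ℝ) ⊆ Set.Ici (0:ℝ)) (hy0 : (y : Set ℝ) ⊆ Set.Ici (0:ℝ))
    (hties : ∀ a ∈ x ∪ y, ∀ k, σ k ≠ a)
    (h0 : ∀ s ∈ Set.Icc (0:ℝ) t, Fst x σ s t 0 ≤ Fst y σ s t 0) :
    ∀ s ∈ Set.Icc (0:ℝ) t, ∀ k : ℕ, Fst x σ s t k ≤ Fst y σ s t k := by
  intro s hs k
  induction k generalizing s with
  | zero => exact h0 s hs
  | succ k ih =>
    exact card_filter_Ystep_le
      (notMem_Ychain hσinj (fun a ha => hties a (Finset.mem_union_left _ ha)) k)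
      (notMem_Ychain hσinj (fun a ha => hties a (Finset.mem_union_right _ ha)) k)
      (fun _ ha => Ychain_nonneg hσpos (fun _ hb => hx0 hb) ha) ih s hs

end
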